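/- Let λ ∈ [1/2, 1) and define f_λ : [0,1] → [0,1] by f_λ(x) = λx, which is a contraction. For the fuzzy sets u, v of the Example on I = [0,1], Zadeh's extension of f_λ satisfies d_0(f̃_λ(u), f̃_λ(v)) = 1/4 = d_0(u, v); in particular, f̃_λ : (𝔉(I), d_0) → (𝔉(I), d_0) is not a contraction. -/

import Mathlib

open Set Metric Filter
open scoped Classical

noncomputable section

/-- The `α`-cut `[u]_α = {x | u x ≥ α}` of a fuzzy set for `α ∈ (0,1]`,
and its support `[u]_0 = closure {x | u x > 0}` for `α = 0`. -/
def fcut {X : Type*} [TopologicalSpace X] (u : X → ℝ) (α : ℝ) : Set X :=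
  if α = 0 then closure {x | 0 < u x} else {x | α ≤ u x}

/-- `u ∈ 𝔉(X)`: an upper semicontinuous fuzzy set (with values in `[0,1]`)
whose support is compact and whose `1`-cut is nonempty. -/
def IsFuzzy {X : Type*} [TopologicalSpace X] (u : X → ℝ) : Prop :=
  UpperSemicontinuous u ∧ (∀ x, u x ∈ Icc (0 : ℝ) 1) ∧
    IsCompact (fcut u 0) ∧ (fcut u 1).Nonempty

/-- The level-wise metric `d_∞(u,v) = sup{d_H([u]_α, [v]_α) : α ∈ [0,1]}`. -/
def dInfty {X : Type*} [MetricSpace X] (u v : X → ℝ) : ℝ :=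
  ⨆ α : Icc (0 : ℝ) 1, hausdorffDist (fcut u α.1) (fcut v α.1)

/-- `t ∈ Hom(I)`: a strictly increasing homeomorphism of `I = [0,1]` onto itself
(recorded as a map `ℝ → ℝ`, considered on `[0,1]`). -/
def IsHomI (t : ℝ → ℝ) : Prop :=
  StrictMonoOn t (Icc 0 1) ∧ ContinuousOn t (Icc 0 1) ∧
    MapsTo t (Icc 0 1) (Icc 0 1) ∧ SurjOn t (Icc 0 1) (Icc 0 1)

/-- The Skorokhod metric
`d_0(u,v) = inf{ε > 0 : ∃ t ∈ Hom(I), sup_{x ∈ I} |t x - x| ≤ ε and d_∞(u, t∘v) ≤ ε}`. -/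
def dSk {X : Type*} [MetricSpace X] (u v : X → ℝ) : ℝ :=
  sInf {ε : ℝ | 0 < ε ∧ ∃ t : ℝ → ℝ, IsHomI t ∧
    (∀ x ∈ Icc (0 : ℝ) 1, |t x - x| ≤ ε) ∧ dInfty u (t ∘ v) ≤ ε}

/-- Zadeh's extension of `f`: `f̃(u)(x) = sup{u z : z ∈ f⁻¹(x)}`, which is `0`
when `f⁻¹(x) = ∅` since `sSup ∅ = 0` in `ℝ`. -/
def zadeh {X : Type*} (f : X → X) (u : X → ℝ) : X → ℝ :=
  fun x => sSup (u '' (f ⁻¹' {x}))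

/-- The unit interval `I = [0,1]` as a metric space. -/
abbrev I01 : Type := Set.Icc (0 : ℝ) 1

/-- `a_n = 1 - (5/8)/2^n` (so `a_0 = 3/8`). -/
def aSeq (n : ℕ) : ℝ := 1 - 5 / 8 / 2 ^ n

/-- `a'_0 = 3/8` and `a'_n = 1 - (1/4)/2^n` for `n ≥ 1` (so `a'_1 = 7/8`). -/
def aSeq' (n : ℕ) : ℝ := if n = 0 then 3 / 8 else 1 - 1 / 4 / 2 ^ n

/-- `b'_0 = 1/8` and `b'_n = a'_n` for `n ≥ 1`. -/
def bSeq' (n : ℕ) : ℝ := if n = 0 then 1 / 8 else aSeq' n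

/-- `u(x) = 0` on `[0, 3/8)`, `u(x) = a_n` on `[a'_n, a'_{n+1})`, and `u(1) = 1`. -/
def uAux (x : ℝ) : ℝ :=
  if x = 1 then 1
  else if h : ∃ n : ℕ, aSeq' n ≤ x ∧ x < aSeq' (n + 1) then aSeq h.choose
  else 0

/-- `v(x) = 0` on `[0, 1/8)`, `v(x) = 1/8` on `[1/8, 7/8)`, `v(x) = 5/8` on `[7/8, 15/16)`,
`v(x) = a_{n-1}` on `[b'_n, b'_{n+1})` for `n ≥ 2`, and `v(1) = 1`. -/
def vAux (x : ℝ) : ℝ :=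
  if x = 1 then 1
  else if x < 1 / 8 then 0
  else if x < 7 / 8 then 1 / 8
  else if x < 15 / 16 then 5 / 8
  else if h : ∃ n : ℕ, 2 ≤ n ∧ bSeq' n ≤ x ∧ x < bSeq' (n + 1) then aSeq (h.choose - 1)
  else 0

/-- The fuzzy set `u` of the Example, as a function on `I = [0,1]`. -/
def uEx : I01 → ℝ := fun x => uAux x.1

/-- The fuzzy set `v` of the Example, as a function on `I = [0,1]`. -/
def vEx : I01 → ℝ := fun x => vAux x.1

lemma aSeq_mono : Monotone aSeq := by
  refine monotone_nat_of_le_succ fun n => ?_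
  have : (0 : ℝ) < 5 / 8 / 2 ^ n := by positivity
  have h : (5 / 8 / 2 ^ (n + 1) : ℝ) = 5 / 8 / 2 ^ n / 2 := by rw [pow_succ]; field_simp
  simp only [aSeq, h]
  linarith

lemma aSeq'_strictMono : StrictMono aSeq' := by
  refine strictMono_nat_of_lt_succ fun n => ?_
  rcases n with _ | n
  · norm_num [aSeq']
  · have : (0 : ℝ) < 1 / 4 / 2 ^ (n + 1) := by positivity
    have h : (1 / 4 / 2 ^ (n + 2) : ℝ) = 1 / 4 / 2 ^ (n + 1) / 2 := by
      rw [pow_succ _ (n + 1)]; field_simp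
    simp only [aSeq', Nat.add_eq_zero_iff, one_ne_zero, and_false, if_false]
    rw [show n + 1 + 1 = n + 2 from rfl, h]
    linarith

lemma aSeq_zero : aSeq 0 = 3 / 8 := by norm_num [aSeq]

lemma aSeq_one : aSeq 1 = 11 / 16 := by norm_num [aSeq]

lemma aSeq'_zero : aSeq' 0 = 3 / 8 := by norm_num [aSeq']

lemma aSeq'_one : aSeq' 1 = 7 / 8 := by norm_num [aSeq']

lemma aSeq'_two : aSeq' 2 = 15 / 16 := by norm_num [aSeq']

lemma aSeq_lt_one (n : ℕ) : aSeq n < 1 := by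
  have : (0 : ℝ) < 5 / 8 / 2 ^ n := by positivity
  unfold aSeq; linarith

lemma le_aSeq (n : ℕ) : 3 / 8 ≤ aSeq n := aSeq_zero ▸ aSeq_mono n.zero_le

lemma aSeq'_lt_one (n : ℕ) : aSeq' n < 1 := by
  have : (0 : ℝ) < 1 / 4 / 2 ^ n := by positivity
  unfold aSeq'; split_ifs <;> linarith

lemma le_aSeq' (n : ℕ) : 3 / 8 ≤ aSeq' n := aSeq'_zero ▸ aSeq'_strictMono.monotone n.zero_le

lemma eq_of_mem_step {x : ℝ} {m n : ℕ} (hm : aSeq' m ≤ x ∧ x < aSeq' (m + 1))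
    (hn : aSeq' n ≤ x ∧ x < aSeq' (n + 1)) : m = n := by
  have h₁ := aSeq'_strictMono.lt_iff_lt.1 (hm.1.trans_lt hn.2)
  have h₂ := aSeq'_strictMono.lt_iff_lt.1 (hn.1.trans_lt hm.2)
  omega

lemma exists_step {x : ℝ} (h₀ : 3 / 8 ≤ x) (h₁ : x < 1) :
    ∃ n : ℕ, aSeq' n ≤ x ∧ x < aSeq' (n + 1) := by
  have hex : ∃ n : ℕ, x < aSeq' (n + 1) := by
    obtain ⟨n, hn⟩ := exists_pow_lt_of_lt_one (sub_pos.2 h₁) (by norm_num : (1 / 2 : ℝ) < 1)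
    refine ⟨n, ?_⟩
    have h : (1 / 4 / 2 ^ (n + 1) : ℝ) = (1 / 2) ^ n / 8 := by
      rw [pow_succ, div_pow, one_pow]; field_simp; norm_num
    have : (0 : ℝ) < (1 / 2) ^ n := by positivity
    simp only [aSeq', Nat.add_eq_zero_iff, one_ne_zero, and_false, if_false, h]
    linarith
  refine ⟨Nat.find hex, ?_, Nat.find_spec hex⟩
  rcases hk : Nat.find hex with _ | k
  · rwa [aSeq'_zero]
  · exact not_lt.1 (Nat.find_min hex (hk ▸ k.lt_succ_self))

lemma uAux_of_step {x : ℝ} {n : ℕ} (hn : aSeq' n ≤ x ∧ x < aSeq' (n + 1)) :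
    uAux x = aSeq n := by
  have h : ∃ n : ℕ, aSeq' n ≤ x ∧ x < aSeq' (n + 1) := ⟨n, hn⟩
  rw [uAux, if_neg (hn.2.trans (aSeq'_lt_one _)).ne, dif_pos h, eq_of_mem_step h.choose_spec hn]

lemma uAux_of_lt {x : ℝ} (hx : x < 3 / 8) : uAux x = 0 := by
  rw [uAux, if_neg (by linarith), dif_neg]
  rintro ⟨n, hn, -⟩
  linarith [le_aSeq' n]

lemma uAux_one : uAux 1 = 1 := if_pos rfl

lemma uAux_three_eighths : uAux (3 / 8) = 3 / 8 := by
  rw [uAux_of_step (n := 0) (by rw [aSeq'_zero, aSeq'_one]; norm_num), aSeq_zero]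

lemma uAux_mem (x : ℝ) : uAux x ∈ Icc (0 : ℝ) 1 := by
  unfold uAux
  split_ifs with _ h
  · simp
  · exact ⟨by linarith [le_aSeq h.choose], (aSeq_lt_one _).le⟩
  · simp

/-- Upper semicontinuity of the step function `uAux`, in an order-theoretic form. -/
lemma exists_uAux_le {x : ℝ} (hx : x < 1) : ∃ c > x, ∀ y < c, uAux y ≤ uAux x := by
  rcases lt_or_ge x (3 / 8) with h | h
  · exact ⟨3 / 8, h, fun y hy => by rw [uAux_of_lt hy, uAux_of_lt h]⟩
  obtain ⟨n, hn⟩ := exists_step h hx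
  refine ⟨aSeq' (n + 1), hn.2, fun y hy => ?_⟩
  rcases lt_or_ge y (3 / 8) with h' | h'
  · rw [uAux_of_lt h']; exact (uAux_mem x).1
  obtain ⟨m, hm⟩ := exists_step h' (hy.trans (aSeq'_lt_one _))
  rw [uAux_of_step hm, uAux_of_step hn]
  exact aSeq_mono (Nat.lt_succ_iff.1 (aSeq'_strictMono.lt_iff_lt.1 (hm.1.trans_lt hy)))

lemma vAux_of_step {x : ℝ} {n : ℕ} (h2 : 2 ≤ n) (hn : aSeq' n ≤ x ∧ x < aSeq' (n + 1)) :
    vAux x = aSeq (n - 1) := by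
  have hx : 15 / 16 ≤ x := aSeq'_two ▸ (aSeq'_strictMono.monotone h2).trans hn.1
  have hb : ∀ m, 2 ≤ m → bSeq' m = aSeq' m := fun m hm => if_neg (by omega)
  have h : ∃ n : ℕ, 2 ≤ n ∧ bSeq' n ≤ x ∧ x < bSeq' (n + 1) :=
    ⟨n, h2, by rwa [hb n h2, hb (n + 1) (by omega)]⟩
  have hs := h.choose_spec
  rw [hb _ hs.1, hb _ (by omega)] at hs
  rw [vAux, if_neg (hn.2.trans (aSeq'_lt_one _)).ne, if_neg (by linarith), if_neg (by linarith),
    if_neg (by linarith), dif_pos h, eq_of_mem_step hs.2 hn]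

lemma vAux_mem (x : ℝ) : vAux x ∈ Icc (0 : ℝ) 1 := by
  unfold vAux
  split_ifs with _ _ _ _ h
  any_goals norm_num
  exact ⟨by linarith [le_aSeq (h.choose - 1)], (aSeq_lt_one _).le⟩

lemma vAux_one : vAux 1 = 1 := if_pos rfl

lemma le_of_lt_vAux {x : ℝ} (hx : 1 / 8 < vAux x) : 7 / 8 ≤ x := by
  by_contra! h
  rw [vAux, if_neg (by linarith)] at hx
  split_ifs at hx <;> linarith

/-- The piecewise linear homeomorphism of `[0,1]` through `(1/8, 3/8)`, `(5/8, 11/16)` and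
`(11/16, 27/32)`. -/
def stepHom (x : ℝ) : ℝ :=
  min (3 * x) (max (5 / 8 * x + 19 / 64) (min (5 / 2 * x - 7 / 8) (1 / 2 * x + 1 / 2)))

lemma stepHom_strictMono : StrictMono stepHom := by
  have lin : ∀ a b : ℝ, 0 < a → StrictMono fun x => a * x + b := fun a b ha x y h => by
    simpa using mul_lt_mul_of_pos_left h ha
  have h₁ := lin 3 0 (by norm_num)
  have h₃ := lin (5 / 2) (-(7 / 8)) (by norm_num)
  simp only [add_zero, ← sub_eq_add_neg] at h₁ h₃
  exact fun x y h => min_lt_min (h₁ h) (max_lt_max (lin (5 / 8) (19 / 64) (by norm_num) h)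
    (min_lt_min (h₃ h) (lin (1 / 2) (1 / 2) (by norm_num) h)))

lemma stepHom_zero : stepHom 0 = 0 := by norm_num [stepHom]

lemma stepHom_one : stepHom 1 = 1 := by norm_num [stepHom]

lemma isHomI_stepHom : IsHomI stepHom := by
  have hc : Continuous stepHom := by unfold stepHom; fun_prop
  refine ⟨stepHom_strictMono.strictMonoOn _, hc.continuousOn, fun x hx => ?_, ?_⟩
  · exact ⟨stepHom_zero ▸ stepHom_strictMono.monotone hx.1,
      stepHom_one ▸ stepHom_strictMono.monotone hx.2⟩
  · have := intermediate_value_Icc (zero_le_one' ℝ) hc.continuousOn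
    rwa [stepHom_zero, stepHom_one] at this

lemma abs_stepHom_sub_le {x : ℝ} (hx : x ∈ Icc (0 : ℝ) 1) : |stepHom x - x| ≤ 1 / 4 := by
  obtain ⟨h₀, h₁⟩ := hx
  rw [abs_le]
  unfold stepHom
  constructor
  · have : x - 1 / 4 ≤ min (3 * x) (max (5 / 8 * x + 19 / 64)
        (min (5 / 2 * x - 7 / 8) (1 / 2 * x + 1 / 2))) := by
      refine le_min (by linarith) (le_max_of_le_left (by linarith))
    linarith
  · rw [sub_le_iff_le_add]
    rcases le_total x (1 / 8) with h | h
    · exact min_le_of_left_le (by linarith)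
    · refine min_le_of_right_le (max_le (by linarith) ?_)
      rcases le_total x (11 / 16) with h' | h'
      · exact min_le_of_left_le (by linarith)
      · exact min_le_of_right_le (by linarith)

lemma stepHom_aSeq {n : ℕ} (hn : 1 ≤ n) : stepHom (aSeq n) = aSeq (n + 1) := by
  have h := aSeq_mono hn
  rw [aSeq_one] at h
  have h₁ := aSeq_lt_one n
  have hs : aSeq (n + 1) = 1 / 2 * aSeq n + 1 / 2 := by
    simp only [aSeq, pow_succ]; field_simp; ring
  rw [stepHom, min_eq_right (a := 5 / 2 * aSeq n - 7 / 8) (by linarith),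
    max_eq_right (by linarith), min_eq_right (by linarith), hs]

lemma stepHom_vAux {x : ℝ} (hx : x ≤ 1) :
    stepHom (vAux x) = if x < 1 / 8 then 0 else uAux (max x (3 / 8)) := by
  split_ifs with h
  · rw [vAux, if_neg (by linarith), if_pos h, stepHom_zero]
  rcases hx.eq_or_lt with rfl | h1
  · rw [vAux_one, stepHom_one, max_eq_left (by norm_num), uAux_one]
  rcases lt_or_ge x (7 / 8) with h2 | h2
  · rw [vAux, if_neg h1.ne, if_neg h, if_pos h2, uAux_of_step (n := 0), aSeq_zero]
    · norm_num [stepHom]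
    · rw [aSeq'_zero, aSeq'_one]
      exact ⟨le_max_right _ _, max_lt h2 (by norm_num)⟩
  rw [max_eq_left (by linarith)]
  rcases lt_or_ge x (15 / 16) with h3 | h3
  · rw [vAux, if_neg h1.ne, if_neg h, if_neg h2.not_gt, if_pos h3, uAux_of_step (n := 1),
      aSeq_one]
    · norm_num [stepHom]
    · rw [aSeq'_one, aSeq'_two]
      exact ⟨h2, h3⟩
  · obtain ⟨n, hn⟩ := exists_step (x := x) (by linarith) h1
    have h2n : 2 ≤ n := Nat.lt_succ_iff.1
      (aSeq'_strictMono.lt_iff_lt.1 ((aSeq'_two ▸ h3).trans_lt hn.2))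
    rw [vAux_of_step h2n hn, uAux_of_step hn, stepHom_aSeq (by omega)]
    congr 1
    omega

lemma exists_vAux_le {x : ℝ} (hx : x < 1) : ∃ c > x, ∀ y < c, y ≤ 1 → vAux y ≤ vAux x := by
  suffices ∃ c > x, ∀ y < c, y ≤ 1 → stepHom (vAux y) ≤ stepHom (vAux x) by
    simpa only [stepHom_strictMono.le_iff_le] using this
  rcases lt_or_ge x (1 / 8) with h | h
  · refine ⟨1 / 8, h, fun y hy hy1 => ?_⟩
    rw [stepHom_vAux hy1, stepHom_vAux hx.le, if_pos hy, if_pos h]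
  · obtain ⟨c, hc, hle⟩ := exists_uAux_le (x := max x (3 / 8)) (max_lt hx (by norm_num))
    refine ⟨c, (le_max_left _ _).trans_lt hc, fun y hy hy1 => ?_⟩
    rw [stepHom_vAux hy1, stepHom_vAux hx.le, if_neg h.not_gt]
    split_ifs
    · exact (uAux_mem _).1
    · exact hle _ (max_lt hy ((le_max_right _ _).trans_lt hc))

lemma isFuzzy_of_exists_le {g : ℝ → ℝ} (hmem : ∀ x, g x ∈ Icc (0 : ℝ) 1) (h1 : g 1 = 1)
    (hle : ∀ x < 1, ∃ c > x, ∀ y < c, y ≤ 1 → g y ≤ g x) :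
    IsFuzzy fun x : I01 => g x := by
  refine ⟨fun x z hz => ?_, fun x => hmem x, ?_, ⟨1, ?_⟩⟩
  · change g x < z at hz
    change ∀ᶠ y : I01 in nhds x, g y < z
    rcases x.2.2.eq_or_lt with hx | hx
    · rw [hx, h1] at hz
      exact Eventually.of_forall fun y => (hmem y).2.trans_lt hz
    · obtain ⟨c, hc, hle⟩ := hle x hx
      filter_upwards [continuous_subtype_val.continuousAt.eventually_lt_const hc] with y hy
      exact (hle y hy y.2.2).trans_lt hz
  · rw [fcut, if_pos rfl]
    exact isClosed_closure.isCompact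
  · simp [fcut, h1]

lemma isFuzzy_uEx : IsFuzzy uEx :=
  isFuzzy_of_exists_le uAux_mem uAux_one fun _ hx =>
    (exists_uAux_le hx).imp fun _ h => ⟨h.1, fun y hy _ => h.2 y hy⟩

lemma isFuzzy_vEx : IsFuzzy vEx :=
  isFuzzy_of_exists_le vAux_mem vAux_one fun _ hx => exists_vAux_le hx

lemma zadeh_apply {X : Type*} {f : X → X} (hf : Function.Injective f) (u : X → ℝ) (x : X) :
    zadeh f u (f x) = u x := by
  have : f ⁻¹' {f x} = {x} := by ext; simp [hf.eq_iff]
  simp [zadeh, this]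

lemma zadeh_of_notMem_range {X : Type*} {f : X → X} (u : X → ℝ) {x : X} (hx : x ∉ range f) :
    zadeh f u x = 0 := by
  rw [zadeh, preimage_singleton_eq_empty.2 hx, image_empty, Real.sSup_empty]

lemma bddAbove_hausdorffDist_fcut (u v : I01 → ℝ) :
    BddAbove (range fun α : Icc (0 : ℝ) 1 => hausdorffDist (fcut u α.1) (fcut v α.1)) := by
  refine ⟨1, ?_⟩
  rintro _ ⟨α, rfl⟩
  dsimp only
  rcases (fcut u α.1).eq_empty_or_nonempty with h | ⟨x, hx⟩
  · simp [h]
  rcases (fcut v α.1).eq_empty_or_nonempty with h | ⟨y, hy⟩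
  · simp [h]
  have hd : ∀ x y : I01, dist x y ≤ 1 := fun x y => by
    rw [Subtype.dist_eq, Real.dist_eq, abs_le]
    constructor <;> linarith [x.2.1, x.2.2, y.2.1, y.2.2]
  exact hausdorffDist_le_of_mem_dist zero_le_one (fun a _ => ⟨y, hy, hd _ _⟩)
    fun a _ => ⟨x, hx, hd _ _⟩

section Scaling

variable {l : ℝ} {f : I01 → I01}

lemma dist_scaling (hl : 0 ≤ l) (hf : ∀ x : I01, (f x : ℝ) = l * (x : ℝ)) (x y : I01) :
    dist (f x) (f y) = l * dist x y := by
  rw [Subtype.dist_eq, Subtype.dist_eq, Real.dist_eq, Real.dist_eq, hf, hf, ← mul_sub, abs_mul,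
    abs_of_nonneg hl]

lemma injective_scaling (hl : 0 < l) (hf : ∀ x : I01, (f x : ℝ) = l * (x : ℝ)) :
    Function.Injective f := fun x y h => by
  have := dist_scaling hl.le hf x y
  rw [h, dist_self, eq_comm, mul_eq_zero] at this
  exact dist_eq_zero.1 (this.resolve_left hl.ne')

lemma dInfty_zadeh_stepHom_le (hl : 0 < l) (hl1 : l ≤ 1)
    (hf : ∀ x : I01, (f x : ℝ) = l * (x : ℝ)) :
    dInfty (zadeh f uEx) (stepHom ∘ zadeh f vEx) ≤ 1 / 4 := by
  have hinj := injective_scaling hl hf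
  have hle : ∀ x, zadeh f uEx x ≤ (stepHom ∘ zadeh f vEx) x := fun x => by
    by_cases hx : x ∈ range f
    · obtain ⟨y, rfl⟩ := hx
      rw [Function.comp_apply, zadeh_apply hinj, zadeh_apply hinj, vEx, stepHom_vAux y.2.2, uEx]
      split_ifs with h
      · rw [uAux_of_lt (by linarith)]
      · rcases lt_or_ge (y : ℝ) (3 / 8) with h' | h'
        · rw [uAux_of_lt h']; exact (uAux_mem _).1
        · rw [max_eq_left h']
    · rw [Function.comp_apply, zadeh_of_notMem_range _ hx, zadeh_of_notMem_range _ hx,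
        stepHom_zero]
  have hge : ∀ x, 0 < (stepHom ∘ zadeh f vEx) x → ∃ y, dist x y ≤ 1 / 4 ∧
      (stepHom ∘ zadeh f vEx) x ≤ zadeh f uEx y := fun x hpos => by
    by_cases hx : x ∈ range f
    · obtain ⟨y, rfl⟩ := hx
      rw [Function.comp_apply, zadeh_apply hinj, vEx, stepHom_vAux y.2.2] at hpos ⊢
      split_ifs at hpos ⊢ with h
      · exact absurd hpos (lt_irrefl 0)
      refine ⟨f ⟨max y (3 / 8), le_max_of_le_left y.2.1, max_le y.2.2 (by norm_num)⟩, ?_, ?_⟩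
      · rw [dist_scaling hl.le hf]
        refine (mul_le_of_le_one_left dist_nonneg hl1).trans ?_
        rw [Subtype.dist_eq, dist_comm, Real.dist_eq, abs_of_nonneg (by simp),
          sub_le_iff_le_add]
        exact max_le (by linarith) (by linarith)
      · rw [zadeh_apply hinj, uEx]
    · rw [Function.comp_apply, zadeh_of_notMem_range _ hx, stepHom_zero] at hpos
      exact absurd hpos (lt_irrefl 0)
  refine ciSup_le fun ⟨α, hα⟩ => ?_
  rcases hα.1.eq_or_lt with rfl | hpos
  · simp only [fcut, if_true, hausdorffDist_closure]
    refine hausdorffDist_le_of_mem_dist (by norm_num)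
      (fun x hx => ⟨x, lt_of_lt_of_le hx (hle x), by rw [dist_self]; norm_num⟩) fun x hx => ?_
    obtain ⟨y, hd, hy⟩ := hge x hx
    exact ⟨y, lt_of_lt_of_le hx hy, hd⟩
  · simp only [fcut, hpos.ne', if_false]
    refine hausdorffDist_le_of_mem_dist (by norm_num)
      (fun x hx => ⟨x, le_trans hx (hle x), by rw [dist_self]; norm_num⟩) fun x hx => ?_
    obtain ⟨y, hd, hy⟩ := hge x (hpos.trans_le hx)
    exact ⟨y, le_trans hx hy, hd⟩

lemma le_dInfty_zadeh (hl : 1 / 2 ≤ l) (hf : ∀ x : I01, (f x : ℝ) = l * (x : ℝ))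
    {t : ℝ → ℝ} (ht : IsHomI t) (h8 : t (1 / 8) < 3 / 8) :
    1 / 4 ≤ dInfty (zadeh f uEx) (t ∘ zadeh f vEx) := by
  have hl0 : 0 < l := by linarith
  have hinj := injective_scaling hl0 hf
  have hm := ht.1.monotoneOn
  have hp : (1 / 8 : ℝ) ∈ Icc (0 : ℝ) 1 := by norm_num
  refine le_trans ?_ (le_ciSup (bddAbove_hausdorffDist_fcut _ _) ⟨3 / 8, by norm_num⟩)
  simp only [fcut, show (3 / 8 : ℝ) ≠ 0 by norm_num, if_false]
  set x₀ : I01 := ⟨3 / 8, by norm_num⟩ with hx₀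
  have hA : f x₀ ∈ {x | 3 / 8 ≤ zadeh f uEx x} := by
    rw [mem_ofPred_eq, zadeh_apply hinj, uEx, uAux_three_eighths]
  have hB : f 1 ∈ {x | 3 / 8 ≤ (t ∘ zadeh f vEx) x} := by
    obtain ⟨s, hs, hts⟩ := ht.2.2.2 (right_mem_Icc.2 (zero_le_one' ℝ))
    have := hm hs (right_mem_Icc.2 zero_le_one) hs.2
    rw [mem_ofPred_eq, Function.comp_apply, zadeh_apply hinj]
    change 3 / 8 ≤ t (vAux 1)
    rw [vAux_one]
    linarith
  by_contra! hlt
  obtain ⟨y, hy, hd⟩ := exists_dist_lt_of_hausdorffDist_lt hA hlt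
    (hausdorffEDist_ne_top_of_nonempty_of_bounded ⟨_, hA⟩ ⟨_, hB⟩
      (isBounded_of_compactSpace) (isBounded_of_compactSpace))
  rw [mem_ofPred_eq, Function.comp_apply] at hy
  by_cases hr : y ∈ range f
  · obtain ⟨z, rfl⟩ := hr
    rw [zadeh_apply hinj] at hy
    have hz : 7 / 8 ≤ (z : ℝ) := le_of_lt_vAux <| by
      by_contra! h
      have := hm (vAux_mem z) hp h
      rw [vEx] at hy
      linarith
    rw [dist_scaling hl0.le hf, dist_comm, Subtype.dist_eq, Real.dist_eq,
      abs_of_nonneg (by simp only [hx₀]; linarith)] at hd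
    simp only [hx₀] at hd
    nlinarith
  · rw [zadeh_of_notMem_range _ hr] at hy
    have := hm (left_mem_Icc.2 (zero_le_one' ℝ)) hp hp.1
    linarith

lemma dSk_zadeh (hl : 1 / 2 ≤ l) (hl1 : l ≤ 1) (hf : ∀ x : I01, (f x : ℝ) = l * (x : ℝ)) :
    dSk (zadeh f uEx) (zadeh f vEx) = 1 / 4 := by
  refine IsLeast.csInf_eq ⟨⟨by norm_num, stepHom, isHomI_stepHom, fun x => abs_stepHom_sub_le,
    dInfty_zadeh_stepHom_le (by linarith) hl1 hf⟩, ?_⟩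
  rintro ε ⟨-, t, ht, hε, hd⟩
  by_contra! h
  have := (abs_le.1 (hε (1 / 8) (by norm_num))).2
  linarith [le_dInfty_zadeh hl hf ht (by linarith)]

end Scaling

lemma dSk_uEx_vEx : dSk uEx vEx = 1 / 4 := by
  have hid : ∀ u : I01 → ℝ, zadeh id u = u := fun u =>
    funext fun x => zadeh_apply Function.injective_id u x
  simpa only [hid] using
    dSk_zadeh (l := 1) (f := id) (by norm_num) le_rfl fun x => (one_mul _).symm

/-- For `λ ∈ [1/2, 1)` and `f_λ(x) = λx` on `[0,1]` (a contraction), Zadeh's extension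
satisfies `d_0(f̃_λ(u), f̃_λ(v)) = 1/4 = d_0(u, v)`; in particular `f̃_λ` is not a
contraction on `(𝔉(I), d_0)`. -/
theorem statement11 (l : ℝ) (hl : l ∈ Ico (1 / 2 : ℝ) 1)
    (f : I01 → I01) (hf : ∀ x : I01, (f x : ℝ) = l * (x : ℝ)) :
    (∀ x y : I01, dist (f x) (f y) ≤ l * dist x y) ∧
    dSk (zadeh f uEx) (zadeh f vEx) = 1 / 4 ∧
    dSk uEx vEx = 1 / 4 ∧
    ¬ ∃ μ : ℝ, 0 ≤ μ ∧ μ < 1 ∧ ∀ u v : I01 → ℝ, IsFuzzy u → IsFuzzy v →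
      dSk (zadeh f u) (zadeh f v) ≤ μ * dSk u v := by
  have h := dSk_zadeh hl.1 hl.2.le hf
  refine ⟨fun x y => (dist_scaling (by linarith [hl.1]) hf x y).le, h, dSk_uEx_vEx, ?_⟩
  rintro ⟨μ, -, hμ, hc⟩
  have := hc uEx vEx isFuzzy_uEx isFuzzy_vEx
  rw [h, dSk_uEx_vEx] at this
  linarith
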